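/- Theorem 2 (time-dependent errors): Let Λ_1, …, Λ_m be linear maps on the space of 2^n × 2^n complex matrices (the error processes sampled in different circuit realizations) and let w_1, …, w_m be nonnegative reals summing to 1. Then the Pauli twirl of the averaged map ∑_a w_a Λ_a is diagonal in the Pauli-word basis: for any distinct g, h : Fin n → Fin 4, Tr(P_g · T(∑_a w_a Λ_a)(P_h)) = 0, and moreover T(∑_a w_a Λ_a) = ∑_a w_a T(Λ_a). -/

import Mathlib

open Matrix

/-- The single-qubit Pauli matrices σ₀ = I, σ₁ = X, σ₂ = Y, σ₃ = Z. -/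
noncomputable def pauli : Fin 4 → Matrix (Fin 2) (Fin 2) ℂ
  | 0 => !![1, 0; 0, 1]
  | 1 => !![0, 1; 1, 0]
  | 2 => !![0, -Complex.I; Complex.I, 0]
  | 3 => !![1, 0; 0, -1]

/-- The n-qubit Pauli word `P_f = ⊗ᵢ σ_{f i}`, as a matrix indexed by `Fin n → Fin 2`. -/
noncomputable def pauliWord (n : ℕ) (f : Fin n → Fin 4) :
    Matrix (Fin n → Fin 2) (Fin n → Fin 2) ℂ :=
  Matrix.of fun x y => ∏ i, pauli (f i) (x i) (y i)

/-- The Pauli twirl of a linear map Λ on n-qubit matrices: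
`T(Λ)(ρ) = 4^{-n} ∑_f P_f ⬝ Λ(P_f ⬝ ρ ⬝ P_f) ⬝ P_f`. -/
noncomputable def pauliTwirl {n : ℕ}
    (Λ : Matrix (Fin n → Fin 2) (Fin n → Fin 2) ℂ →ₗ[ℂ]
         Matrix (Fin n → Fin 2) (Fin n → Fin 2) ℂ)
    (ρ : Matrix (Fin n → Fin 2) (Fin n → Fin 2) ℂ) :
    Matrix (Fin n → Fin 2) (Fin n → Fin 2) ℂ :=
  ((4 : ℂ) ^ n)⁻¹ • ∑ f : Fin n → Fin 4,
    pauliWord n f * Λ (pauliWord n f * ρ * pauliWord n f) * pauliWord n f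

/-- The sign by which the single-qubit Pauli matrices `σ_a` and `σ_b` commute. -/
def pauliSign (a b : Fin 4) : ℤ :=
  if a = 0 ∨ b = 0 ∨ a = b then 1 else -1

theorem pauli_conj (a b : Fin 4) :
    pauli a * pauli b * pauli a = (pauliSign a b : ℂ) • pauli b := by
  fin_cases a <;> fin_cases b <;> ext i j <;> fin_cases i <;> fin_cases j <;>
    simp [pauli, pauliSign, Matrix.mul_apply, Fin.sum_univ_two]

theorem sum_pauliSign_mul_pauliSign {b c : Fin 4} (hbc : b ≠ c) :
    ∑ a, pauliSign a b * pauliSign a c = 0 := by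
  revert b c
  decide

theorem of_prod_mul_of_prod {ι κ R : Type*} [Fintype ι] [DecidableEq ι] [Fintype κ]
    [CommSemiring R] (A B : ι → Matrix κ κ R) :
    (Matrix.of fun x y : ι → κ => ∏ i, A i (x i) (y i)) *
        (Matrix.of fun x y : ι → κ => ∏ i, B i (x i) (y i)) =
      Matrix.of fun x y : ι → κ => ∏ i, (A i * B i) (x i) (y i) := by
  ext x y
  simp only [Matrix.mul_apply, Matrix.of_apply, ← Finset.prod_mul_distrib, Fintype.prod_sum]

theorem pauliWord_conj (n : ℕ) (f g : Fin n → Fin 4) :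
    pauliWord n f * pauliWord n g * pauliWord n f =
      (∏ i, (pauliSign (f i) (g i) : ℂ)) • pauliWord n g := by
  simp only [pauliWord]
  rw [of_prod_mul_of_prod (fun i => pauli (f i)) (fun i => pauli (g i)),
    of_prod_mul_of_prod (fun i => pauli (f i) * pauli (g i)) (fun i => pauli (f i))]
  ext x y
  simp [pauli_conj, Finset.prod_mul_distrib]

theorem sum_prod_pauliSign_mul_prod_pauliSign {n : ℕ} {g h : Fin n → Fin 4} (hgh : g ≠ h) :
    ∑ f : Fin n → Fin 4,
      (∏ i, (pauliSign (f i) (g i) : ℂ)) * ∏ i, (pauliSign (f i) (h i) : ℂ) = 0 := by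
  obtain ⟨i, hi⟩ := Function.ne_iff.mp hgh
  simp only [← Finset.prod_mul_distrib]
  rw [← Fintype.prod_sum fun i a => (pauliSign a (g i) : ℂ) * (pauliSign a (h i) : ℂ)]
  exact Finset.prod_eq_zero (Finset.mem_univ i) (mod_cast sum_pauliSign_mul_pauliSign hi)

theorem trace_pauliWord_mul_pauliTwirl {n : ℕ}
    (Λ : Matrix (Fin n → Fin 2) (Fin n → Fin 2) ℂ →ₗ[ℂ]
         Matrix (Fin n → Fin 2) (Fin n → Fin 2) ℂ)
    {g h : Fin n → Fin 4} (hgh : g ≠ h) :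
    Matrix.trace (pauliWord n g * pauliTwirl Λ (pauliWord n h)) = 0 := by
  have key (f : Fin n → Fin 4) :
      Matrix.trace (pauliWord n g * (pauliWord n f *
        Λ (pauliWord n f * pauliWord n h * pauliWord n f) * pauliWord n f)) =
      ((∏ i, (pauliSign (f i) (g i) : ℂ)) * ∏ i, (pauliSign (f i) (h i) : ℂ)) *
        Matrix.trace (pauliWord n g * Λ (pauliWord n h)) := by
    rw [← Matrix.mul_assoc, Matrix.trace_mul_comm, ← Matrix.mul_assoc, ← Matrix.mul_assoc,
      pauliWord_conj, pauliWord_conj, map_smul, Matrix.smul_mul, Matrix.mul_smul,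
      Matrix.trace_smul, Matrix.trace_smul, smul_eq_mul, smul_eq_mul, mul_assoc]
  rw [pauliTwirl, Matrix.mul_smul, Matrix.trace_smul, Finset.mul_sum, Matrix.trace_sum,
    Finset.sum_congr rfl fun f _ => key f, ← Finset.sum_mul,
    sum_prod_pauliSign_mul_prod_pauliSign hgh, zero_mul, smul_zero]

theorem pauliTwirl_sum_smul {n : ℕ} {ι : Type*} [Fintype ι] (c : ι → ℂ)
    (Λ : ι → (Matrix (Fin n → Fin 2) (Fin n → Fin 2) ℂ →ₗ[ℂ]
              Matrix (Fin n → Fin 2) (Fin n → Fin 2) ℂ))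
    (ρ : Matrix (Fin n → Fin 2) (Fin n → Fin 2) ℂ) :
    pauliTwirl (∑ a, c a • Λ a) ρ = ∑ a, c a • pauliTwirl (Λ a) ρ := by
  simp only [pauliTwirl, LinearMap.sum_apply, LinearMap.smul_apply, Finset.mul_sum,
    Finset.sum_mul, Matrix.mul_smul, Matrix.smul_mul]
  rw [Finset.sum_comm, Finset.smul_sum]
  refine Finset.sum_congr rfl fun a _ => ?_
  rw [← Finset.smul_sum, smul_comm]

/-- Theorem 2 (time-dependent errors): the Pauli twirl of a convex combination
`∑ₐ wₐ Λₐ` of error maps is diagonal in the Pauli-word basis, and the twirl of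
the average equals the average of the twirls. -/
theorem pauliTwirl_average (n m : ℕ)
    (Λ : Fin m → (Matrix (Fin n → Fin 2) (Fin n → Fin 2) ℂ →ₗ[ℂ]
                  Matrix (Fin n → Fin 2) (Fin n → Fin 2) ℂ))
    (w : Fin m → ℝ) (hw : ∀ a, 0 ≤ w a) (hsum : ∑ a, w a = 1) :
    (∀ g h : Fin n → Fin 4, g ≠ h →
      Matrix.trace (pauliWord n g *
        pauliTwirl (∑ a, (w a : ℂ) • Λ a) (pauliWord n h)) = 0) ∧
    (∀ ρ : Matrix (Fin n → Fin 2) (Fin n → Fin 2) ℂ,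
      pauliTwirl (∑ a, (w a : ℂ) • Λ a) ρ =
        ∑ a, (w a : ℂ) • pauliTwirl (Λ a) ρ) := by
  exact ⟨fun _ _ hgh => trace_pauliWord_mul_pauliTwirl _ hgh,
    pauliTwirl_sum_smul (fun a => (w a : ℂ)) Λ⟩
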